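/- Let A = σ(R)⟨x_1,…,x_n⟩ be a bijective skew PBW extension of a ring R, where R is Σ-rigid, Abelian, and NI. If R is a right p.p.-ring, then A has Property (a.c.) on the right. -/

import Mathlib

/-! Basic annihilator-condition definitions for (noncommutative) rings. -/

/-- The right annihilator `r_S(X) = {a ∈ S | Xa = 0}` of a subset `X` of a ring `S`. -/
def rAnn {S : Type*} [Ring S] (X : Set S) : Set S := {a | ∀ x ∈ X, x * a = 0}

/-- The left annihilator `ℓ_S(X) = {a ∈ S | aX = 0}` of a subset `X` of a ring `S`. -/
def lAnn {S : Type*} [Ring S] (X : Set S) : Set S := {a | ∀ x ∈ X, a * x = 0}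

/-- The principal right ideal `xS` of a ring `S`. -/
def rIdeal {S : Type*} [Ring S] (x : S) : Set S := Set.range fun s => x * s

/-- The principal left ideal `Sx` of a ring `S`. -/
def lIdeal {S : Type*} [Ring S] (x : S) : Set S := Set.range fun s => s * x

/-- A ring `S` is Baer if the right annihilator of every nonempty subset is
generated (as a right ideal) by an idempotent. -/
def IsBaerRing (S : Type*) [Ring S] : Prop :=
  ∀ X : Set S, X.Nonempty → ∃ e : S, e * e = e ∧ rAnn X = rIdeal e

/-- A ring `S` is a right p.p.-ring if the right annihilator of every element is
generated by an idempotent. -/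
def IsRightPP (S : Type*) [Ring S] : Prop :=
  ∀ a : S, ∃ e : S, e * e = e ∧ rAnn {a} = rIdeal e

/-- A ring `S` is a left p.p.-ring if the left annihilator of every element is
generated by an idempotent. -/
def IsLeftPP (S : Type*) [Ring S] : Prop :=
  ∀ a : S, ∃ e : S, e * e = e ∧ lAnn {a} = lIdeal e

/-- A ring `S` is right p.q.-Baer if the right annihilator of every principal right
ideal is generated by an idempotent. -/
def IsRightPQBaer (S : Type*) [Ring S] : Prop :=
  ∀ a : S, ∃ e : S, e * e = e ∧ rAnn (rIdeal a) = rIdeal e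

/-- A ring `S` is left p.q.-Baer if the left annihilator of every principal left
ideal is generated by an idempotent. -/
def IsLeftPQBaer (S : Type*) [Ring S] : Prop :=
  ∀ a : S, ∃ e : S, e * e = e ∧ lAnn (lIdeal a) = lIdeal e

/-- Property (a.c.) on the right: for every finitely generated right ideal
`I = a₁S + ⋯ + a_mS` there is `c` with `r_S(I) = r_S(cS)`. -/
def HasRightAC (S : Type*) [Ring S] : Prop :=
  ∀ (m : ℕ) (a : Fin m → S), ∃ c : S,
    rAnn {y : S | ∃ s : Fin m → S, y = ∑ i, a i * s i} = rAnn (rIdeal c)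

/-- Property (a.c.) on the left: for every finitely generated left ideal
`I = Sa₁ + ⋯ + Sa_m` there is `c` with `ℓ_S(I) = ℓ_S(Sc)`. -/
def HasLeftAC (S : Type*) [Ring S] : Prop :=
  ∀ (m : ℕ) (a : Fin m → S), ∃ c : S,
    lAnn {y : S | ∃ s : Fin m → S, y = ∑ i, s i * a i} = lAnn (lIdeal c)

/-- A ring is Abelian if every idempotent is central. -/
def IsAbelianRing (S : Type*) [Ring S] : Prop :=
  ∀ e : S, e * e = e → ∀ r : S, e * r = r * e

/-- A ring `S` is NI if the set of nilpotent elements coincides with the upper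
nilradical `nil*(S)`, the sum of all (two-sided) nil ideals of `S`. -/
def IsNIRing (S : Type*) [Ring S] : Prop :=
  {a : S | IsNilpotent a} =
    ((sSup {I : TwoSidedIdeal S | ∀ x ∈ I, IsNilpotent x} : TwoSidedIdeal S) : Set S)

/-- `σ^α = σ₁^{α₁} ∘ ⋯ ∘ σₙ^{αₙ}` for a family of ring endomorphisms. -/
def sigmaPow {R : Type*} [Ring R] {n : ℕ} (σ : Fin n → R →+* R) (α : Fin n → ℕ) : R → R :=
  (List.ofFn fun i => (⇑(σ i))^[α i]).foldr (· ∘ ·) id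

/-- `δ^α = δ₁^{α₁} ∘ ⋯ ∘ δₙ^{αₙ}` for a family of maps. -/
def deltaPow {R : Type*} {n : ℕ} (δ : Fin n → R → R) (α : Fin n → ℕ) : R → R :=
  (List.ofFn fun i => (δ i)^[α i]).foldr (· ∘ ·) id

/-- The ordered standard monomial `x^α = x₁^{α₁} ⋯ xₙ^{αₙ}`. -/
def monom {A : Type*} [Ring A] {n : ℕ} (x : Fin n → A) (α : Fin n → ℕ) : A :=
  (List.ofFn fun i => x i ^ α i).prod

/-- A skew PBW extension `A = σ(R)⟨x₁,…,xₙ⟩` of a ring `R`: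
`R` embeds in `A` (sharing the identity), `A` is a free left `R`-module with basis the
standard monomials, there are injective endomorphisms `σᵢ` and `σᵢ`-derivations `δᵢ`
with `xᵢ r = σᵢ(r) xᵢ + δᵢ(r)`, and `xⱼxᵢ - d_{i,j} xᵢxⱼ ∈ R + Rx₁ + ⋯ + Rxₙ`
with `d_{i,j} ≠ 0`. -/
structure SkewPBWExt (R A : Type*) [Ring R] [Ring A] (n : ℕ) where
  /-- the inclusion of `R` into `A` -/
  ι : R →+* A
  ι_inj : Function.Injective ι
  /-- the variables `x₁, …, xₙ` -/
  x : Fin n → A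
  /-- the endomorphisms `σᵢ` -/
  σ : Fin n → R →+* R
  σ_inj : ∀ i, Function.Injective (σ i)
  /-- the `σᵢ`-derivations `δᵢ` -/
  δ : Fin n → R → R
  δ_add : ∀ (i : Fin n) (a b : R), δ i (a + b) = δ i a + δ i b
  δ_leibniz : ∀ (i : Fin n) (a b : R), δ i (a * b) = σ i a * δ i b + δ i a * b
  comm_rel : ∀ (i : Fin n) (r : R), x i * ι r = ι (σ i r) * x i + ι (δ i r)
  /-- `A` is a free left `R`-module with basis the standard monomials: every element
  has a unique representation as a finite left `R`-linear combination of monomials. -/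
  basis : ∀ f : A, ∃! c : (Fin n → ℕ) →₀ R, f = c.sum fun α r => ι r * monom x α
  /-- the constants `d_{i,j}` -/
  d : Fin n → Fin n → R
  d_ne : ∀ i j, d i j ≠ 0
  quad : ∀ i j, ∃ (r0 : R) (rc : Fin n → R),
    x j * x i - ι (d i j) * (x i * x j) = ι r0 + ∑ k, ι (rc k) * x k

namespace SkewPBWExt

variable {R A : Type*} [Ring R] [Ring A] {n : ℕ}

/-- `R` is `(Σ,Δ)`-compatible. -/
def SigmaDeltaCompatible (E : SkewPBWExt R A n) : Prop :=
  ∀ (a b : R) (α : Fin n → ℕ),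
    (a * b = 0 ↔ a * sigmaPow E.σ α b = 0) ∧ (a * b = 0 → a * deltaPow E.δ α b = 0)

/-- `R` is `Σ`-rigid. -/
def SigmaRigid (E : SkewPBWExt R A n) : Prop :=
  ∀ (a : R) (α : Fin n → ℕ), a * sigmaPow E.σ α a = 0 → a = 0

/-- Condition (SA1): if `fg = 0` in `A` then all products of coefficients vanish. -/
def SA1 (E : SkewPBWExt R A n) : Prop :=
  ∀ cf cg : (Fin n → ℕ) →₀ R,
    (cf.sum fun α r => E.ι r * monom E.x α) * (cg.sum fun β r => E.ι r * monom E.x β) = 0 →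
    ∀ α β, cf α * cg β = 0

/-- The extension is bijective: every `σᵢ` is bijective and every `d_{i,j}` (`i < j`)
is invertible in `R`. -/
def Bijective (E : SkewPBWExt R A n) : Prop :=
  (∀ i, Function.Bijective (E.σ i)) ∧ ∀ i j : Fin n, i < j → IsUnit (E.d i j)

end SkewPBWExt

/-- The total degree of an exponent vector. -/
def totalDeg {n : ℕ} (α : Fin n → ℕ) : ℕ := ∑ i, α i

lemma totalDeg_add {n : ℕ} (α β : Fin n → ℕ) :
    totalDeg (α + β) = totalDeg α + totalDeg β := by
  simp [totalDeg, Finset.sum_add_distrib]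

@[simp] lemma totalDeg_single {n : ℕ} (i : Fin n) : totalDeg (Pi.single i 1) = 1 := by
  simp [totalDeg]

/-- The degree-lexicographic key of an exponent vector: exponent vectors are compared first by
total degree and then lexicographically. -/
def degLexKey {n : ℕ} (α : Fin n → ℕ) : ℕ ×ₗ Lex (Fin n → ℕ) := toLex (totalDeg α, toLex α)

lemma degLexKey_injective {n : ℕ} :
    Function.Injective (degLexKey : (Fin n → ℕ) → ℕ ×ₗ Lex (Fin n → ℕ)) := fun α β h => by
  simpa [degLexKey] using congrArg (fun p => ofLex (ofLex p).2) h

lemma degLexKey_lt_iff {n : ℕ} {α β : Fin n → ℕ} :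
    degLexKey α < degLexKey β ↔
      totalDeg α < totalDeg β ∨ totalDeg α = totalDeg β ∧ toLex α < toLex β := by
  simp [degLexKey, Prod.Lex.toLex_lt_toLex]

lemma degLexKey_add_lt_add_right {n : ℕ} {α β : Fin n → ℕ} (h : degLexKey α < degLexKey β)
    (γ : Fin n → ℕ) : degLexKey (α + γ) < degLexKey (β + γ) := by
  rw [degLexKey_lt_iff] at h ⊢
  simp only [totalDeg_add, toLex_add]
  rcases h with h | ⟨h, h'⟩
  · exact Or.inl (by omega)
  · exact Or.inr ⟨by omega, add_lt_add_left h' _⟩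

lemma exists_eq_add_single {n : ℕ} {α : Fin n → ℕ} (h : α ≠ 0) :
    ∃ (j : Fin n) (β : Fin n → ℕ), α = β + Pi.single j 1 ∧ (∀ k < j, β k = 0) ∧ α j ≠ 0 := by
  obtain ⟨i, hi⟩ := Function.ne_iff.mp h
  obtain ⟨j, hj, hmin⟩ := wellFounded_lt.has_min {i | α i ≠ 0} ⟨i, hi⟩
  refine ⟨j, α - Pi.single j 1, ?_, fun k hk => ?_, hj⟩
  · ext k
    by_cases hk : k = j
    · subst hk
      have : α k ≠ 0 := hj
      simp only [Pi.add_apply, Pi.sub_apply, Pi.single_eq_same]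
      omega
    · simp [hk]
  · have : α k = 0 := by_contra fun h' => hmin k h' hk
    simp [this]

lemma monom_succ {A : Type*} [Ring A] {n : ℕ} (x : Fin (n + 1) → A) (α : Fin (n + 1) → ℕ) :
    monom x α = x 0 ^ α 0 * monom (fun i => x i.succ) (fun i => α i.succ) := by
  simp [monom, List.ofFn_succ]

@[simp] lemma monom_zero {A : Type*} [Ring A] {n : ℕ} (x : Fin n → A) : monom x 0 = 1 := by
  induction n with
  | zero => simp [monom]
  | succ n ih =>
    rw [monom_succ, Pi.zero_apply, pow_zero, one_mul]
    exact ih _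

lemma mul_monom_of_forall_lt {A : Type*} [Ring A] {n : ℕ} (x : Fin n → A) (i : Fin n)
    (β : Fin n → ℕ) (h : ∀ j < i, β j = 0) :
    x i * monom x β = monom x (β + Pi.single i 1) := by
  induction n with
  | zero => exact i.elim0
  | succ n ih =>
    rw [monom_succ, monom_succ]
    induction i using Fin.cases with
    | zero =>
      simp [pow_succ', mul_assoc]
    | succ i =>
      have h0 : β 0 = 0 := h 0 (Fin.succ_pos i)
      have hsingle : ∀ k : Fin n,
          (Pi.single i.succ 1 : Fin (n + 1) → ℕ) k.succ = (Pi.single i 1 : Fin n → ℕ) k := by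
        intro k
        simp [Pi.single_apply]
      have := ih (fun i => x i.succ) i (fun i => β i.succ)
        fun j hj => h _ (Fin.succ_lt_succ_iff.mpr hj)
      simp only [h0, pow_zero, one_mul, this, Pi.add_apply, hsingle,
        Pi.single_eq_of_ne (Fin.succ_ne_zero i).symm, add_zero]
      rfl

@[simp] lemma sigmaPow_zero {R : Type*} [Ring R] {n : ℕ} (σ : Fin n → R →+* R) :
    sigmaPow σ 0 = id := by
  induction n with
  | zero => simp [sigmaPow]
  | succ n ih =>
    have := ih fun i => σ i.succ
    simp only [sigmaPow, List.ofFn_succ, List.foldr_cons, Pi.zero_apply,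
      Function.iterate_zero] at this ⊢
    rw [this]
    rfl

lemma sigmaPow_single {R : Type*} [Ring R] {n : ℕ} (σ : Fin n → R →+* R) (i : Fin n) :
    sigmaPow σ (Pi.single i 1) = σ i := by
  induction n with
  | zero => exact i.elim0
  | succ n ih =>
    induction i using Fin.cases with
    | zero =>
      have := sigmaPow_zero fun i => σ i.succ
      simp only [sigmaPow, Pi.zero_apply, Function.iterate_zero, List.ofFn_const] at this
      simp [sigmaPow, List.ofFn_succ, Pi.single_apply, Fin.succ_ne_zero, this]
    | succ i =>
      have := ih (fun i => σ i.succ) i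
      simp only [sigmaPow, Pi.single_apply] at this
      simp [sigmaPow, List.ofFn_succ, Pi.single_apply, (Fin.succ_ne_zero _).symm, this]

namespace SkewPBWExt

variable {R A : Type*} [Ring R] [Ring A] {n : ℕ} (E : SkewPBWExt R A n)

/-- The coefficients of an element with respect to the standard monomials. -/
noncomputable def coeff (f : A) : (Fin n → ℕ) →₀ R := (E.basis f).choose

lemma sum_coeff (f : A) : (E.coeff f).sum (fun α r => E.ι r * monom E.x α) = f :=
  (E.basis f).choose_spec.1.symm

lemma coeff_eq_of_sum_eq {f : A} {c : (Fin n → ℕ) →₀ R}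
    (h : c.sum (fun α r => E.ι r * monom E.x α) = f) : E.coeff f = c :=
  ((E.basis f).choose_spec.2 c h.symm).symm

lemma coeff_add (f g : A) : E.coeff (f + g) = E.coeff f + E.coeff g := by
  apply E.coeff_eq_of_sum_eq
  rw [Finsupp.sum_add_index' (by simp) (by simp [add_mul]), sum_coeff, sum_coeff]

@[simp] lemma coeff_zero : E.coeff 0 = 0 := E.coeff_eq_of_sum_eq (by simp)

@[simp] lemma coeff_neg (f : A) : E.coeff (-f) = -E.coeff f :=
  eq_neg_of_add_eq_zero_left (by rw [← coeff_add]; simp)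

lemma coeff_eq_zero_iff {f : A} : E.coeff f = 0 ↔ f = 0 := by
  refine ⟨fun h => ?_, fun h => by simp [h]⟩
  rw [← E.sum_coeff f, h]
  simp

lemma coeff_term (r : R) (α : Fin n → ℕ) :
    E.coeff (E.ι r * monom E.x α) = Finsupp.single α r :=
  E.coeff_eq_of_sum_eq (by simp)

lemma coeff_ι_mul (r : R) (f : A) (α : Fin n → ℕ) :
    E.coeff (E.ι r * f) α = r * E.coeff f α := by
  have : E.coeff (E.ι r * f) = r • E.coeff f := by
    apply E.coeff_eq_of_sum_eq
    rw [Finsupp.sum_smul_index (by simp)]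
    conv_rhs => rw [← E.sum_coeff f]
    simp [Finsupp.sum, Finset.mul_sum, mul_assoc]
  simp [this]

/-- The additive subgroup of left `R`-combinations of the monomials with exponent in `S`. -/
def monomSpan (S : Set (Fin n → ℕ)) : AddSubgroup A :=
  AddSubgroup.closure {y | ∃ (r : R), ∃ α ∈ S, y = E.ι r * monom E.x α}

variable {E}

lemma term_mem_monomSpan {S : Set (Fin n → ℕ)} (r : R) {α : Fin n → ℕ} (h : α ∈ S) :
    E.ι r * monom E.x α ∈ E.monomSpan S :=
  AddSubgroup.subset_closure ⟨r, α, h, rfl⟩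

lemma monomSpan_mono {S T : Set (Fin n → ℕ)} (h : S ⊆ T) : E.monomSpan S ≤ E.monomSpan T :=
  AddSubgroup.closure_mono fun _ ⟨r, α, hα, hy⟩ => ⟨r, α, h hα, hy⟩

lemma mul_mem_of_mem_monomSpan {S : Set (Fin n → ℕ)} {H : AddSubgroup A} {y : A}
    (h : ∀ r, ∀ α ∈ S, y * (E.ι r * monom E.x α) ∈ H) {f : A} (hf : f ∈ E.monomSpan S) :
    y * f ∈ H := by
  induction hf using AddSubgroup.closure_induction with
  | mem z hz =>
    obtain ⟨r, α, hα, rfl⟩ := hz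
    exact h r α hα
  | zero => simp
  | add a b _ _ ha hb => rw [mul_add]; exact H.add_mem ha hb
  | neg a _ ha => rw [mul_neg]; exact H.neg_mem ha

lemma ι_mul_mem_monomSpan {S : Set (Fin n → ℕ)} (r : R) {f : A} (hf : f ∈ E.monomSpan S) :
    E.ι r * f ∈ E.monomSpan S :=
  mul_mem_of_mem_monomSpan (fun s α hα => by
    rw [← mul_assoc, ← map_mul]
    exact term_mem_monomSpan _ hα) hf

lemma coeff_eq_zero_of_mem_monomSpan {S : Set (Fin n → ℕ)} {f : A} (hf : f ∈ E.monomSpan S)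
    {α : Fin n → ℕ} (hα : α ∉ S) : E.coeff f α = 0 := by
  induction hf using AddSubgroup.closure_induction with
  | mem z hz =>
    obtain ⟨r, β, hβ, rfl⟩ := hz
    rw [coeff_term, Finsupp.single_apply, if_neg]
    rintro rfl
    exact hα hβ
  | zero => simp
  | add a b _ _ ha hb => simp [coeff_add, ha, hb]
  | neg a _ ha => simp [ha]

lemma x_mul_ι_mul (i : Fin n) (r : R) (f : A) :
    E.x i * (E.ι r * f) = E.ι (E.σ i r) * (E.x i * f) + E.ι (E.δ i r) * f := by
  rw [← mul_assoc, E.comm_rel, add_mul, mul_assoc]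

lemma x_mul_mem_of_forall_monom {k : ℕ} {i : Fin n}
    (H : ∀ β, totalDeg β ≤ k → E.x i * monom E.x β ∈ E.monomSpan {α | totalDeg α ≤ k + 1})
    {f : A} (hf : f ∈ E.monomSpan {α | totalDeg α ≤ k}) :
    E.x i * f ∈ E.monomSpan {α | totalDeg α ≤ k + 1} :=
  mul_mem_of_mem_monomSpan (fun r α hα => by
    rw [x_mul_ι_mul]
    exact add_mem (ι_mul_mem_monomSpan _ (H α hα))
      (term_mem_monomSpan _ (Nat.le_succ_of_le hα))) hf

/-- Left multiplication by a variable raises a standard monomial by that variable, up to an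
invertible coefficient and terms of lower total degree. -/
lemma x_mul_monom (hd : ∀ i j : Fin n, i < j → IsUnit (E.d i j)) (i : Fin n)
    (β : Fin n → ℕ) :
    ∃ w : R, IsUnit w ∧ E.x i * monom E.x β - E.ι w * monom E.x (β + Pi.single i 1) ∈
      E.monomSpan {α | totalDeg α ≤ totalDeg β} := by
  induction hk : totalDeg β using Nat.strong_induction_on generalizing i β with
  | _ k ih =>
  by_cases hβ : ∀ j < i, β j = 0
  · refine ⟨1, isUnit_one, ?_⟩
    simp [mul_monom_of_forall_lt E.x i β hβ]
  push Not at hβ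
  obtain ⟨l, hl, hβl⟩ := hβ
  obtain ⟨j, β', rfl, hlt, hj⟩ := exists_eq_add_single (α := β) (fun h => hβl (by simp [h]))
  have hji : j < i := by
    refine lt_of_le_of_lt ?_ hl
    by_contra! h
    exact hβl (by simp [hlt l h, h.ne])
  have hdeg : k = totalDeg β' + 1 := by rw [← hk, totalDeg_add, totalDeg_single]
  have hx : ∀ (l : Fin n) (γ : Fin n → ℕ), totalDeg γ ≤ totalDeg β' →
      E.x l * monom E.x γ ∈ E.monomSpan {α | totalDeg α ≤ totalDeg β' + 1} := by
    intro l γ hγ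
    obtain ⟨w, -, hw⟩ := ih (totalDeg γ) (by omega) l γ rfl
    rw [← sub_add_cancel (E.x l * monom E.x γ) (E.ι w * monom E.x (γ + Pi.single l 1))]
    refine add_mem (monomSpan_mono (fun α hα => ?_) hw) (term_mem_monomSpan _ ?_)
    · simp only [Set.mem_ofPred_eq] at hα ⊢
      omega
    · simp only [Set.mem_ofPred_eq, totalDeg_add, totalDeg_single]
      omega
  obtain ⟨w, hw, hρ⟩ := ih (totalDeg β') (by omega) i β' rfl
  obtain ⟨r0, rc, hq⟩ := E.quad j i
  set ρ := E.x i * monom E.x β' - E.ι w * monom E.x (β' + Pi.single i 1) with hρdef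
  have hxi : E.x i * monom E.x β' = E.ι w * monom E.x (β' + Pi.single i 1) + ρ := by
    rw [hρdef]; abel
  have hxj : E.x j * monom E.x (β' + Pi.single i 1) =
      monom E.x (β' + Pi.single j 1 + Pi.single i 1) := by
    rw [mul_monom_of_forall_lt, add_right_comm]
    intro l hl
    simp [hlt l hl, (hl.trans hji).ne]
  refine ⟨E.d j i * E.σ j w, (hd j i hji).mul (hw.map _), ?_⟩
  have key : E.x i * monom E.x (β' + Pi.single j 1) -
      E.ι (E.d j i * E.σ j w) * monom E.x (β' + Pi.single j 1 + Pi.single i 1) =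
      E.ι r0 * monom E.x β' + ∑ l, E.ι (rc l) * (E.x l * monom E.x β') +
      E.ι (E.d j i) * (E.ι (E.δ j w) * monom E.x (β' + Pi.single i 1) + E.x j * ρ) := by
    rw [← mul_monom_of_forall_lt E.x j β' hlt, ← mul_assoc (E.x i), sub_eq_iff_eq_add.mp hq]
    simp only [add_mul, Finset.sum_mul, mul_assoc, hxi, mul_add, x_mul_ι_mul, hxj, map_mul]
    abel
  rw [key, hdeg]
  refine add_mem (add_mem (term_mem_monomSpan _ (Nat.le_succ _)) (sum_mem fun l _ =>
    ι_mul_mem_monomSpan _ (hx l β' le_rfl))) (ι_mul_mem_monomSpan _ (add_mem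
    (term_mem_monomSpan _ ?_) (x_mul_mem_of_forall_monom (hx j) hρ)))
  simp [totalDeg_add]

variable (E) in
/-- The left `R`-combinations of monomials that are degree-lexicographically below `γ`. -/
def below (γ : Fin n → ℕ) : AddSubgroup A := E.monomSpan {μ | degLexKey μ < degLexKey γ}

lemma monomSpan_totalDeg_le_below {k : ℕ} {γ : Fin n → ℕ} (h : k < totalDeg γ) :
    E.monomSpan {α | totalDeg α ≤ k} ≤ E.below γ :=
  monomSpan_mono fun _ hα => degLexKey_lt_iff.mpr (Or.inl (lt_of_le_of_lt hα h))

lemma x_mul_mem_below (hd : ∀ i j : Fin n, i < j → IsUnit (E.d i j)) (i : Fin n)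
    {γ : Fin n → ℕ} {f : A} (hf : f ∈ E.below γ) :
    E.x i * f ∈ E.below (γ + Pi.single i 1) := by
  refine mul_mem_of_mem_monomSpan (fun r μ hμ => ?_) hf
  have hμ' : totalDeg μ < totalDeg (γ + Pi.single i 1) := by
    rw [totalDeg_add, totalDeg_single]
    rcases degLexKey_lt_iff.mp hμ with h | h <;> omega
  obtain ⟨w, -, hw⟩ := x_mul_monom hd i μ
  rw [x_mul_ι_mul, ← sub_add_cancel (E.x i * monom E.x μ)
    (E.ι w * monom E.x (μ + Pi.single i 1))]
  exact add_mem (ι_mul_mem_monomSpan _ (add_mem (monomSpan_totalDeg_le_below hμ' hw)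
    (term_mem_monomSpan _ (degLexKey_add_lt_add_right hμ _))))
    (monomSpan_totalDeg_le_below hμ' (term_mem_monomSpan _ (le_refl (totalDeg μ))))

lemma x_mul_lead (hd : ∀ i j : Fin n, i < j → IsUnit (E.d i j)) (i : Fin n)
    {β : Fin n → ℕ} {b : R} {f : A} (hf : f - E.ι b * monom E.x β ∈ E.below β) :
    ∃ w : R, IsUnit w ∧ E.x i * f - E.ι (E.σ i b * w) * monom E.x (β + Pi.single i 1) ∈
      E.below (β + Pi.single i 1) := by
  obtain ⟨w, hw, hw'⟩ := x_mul_monom hd i β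
  have hβ : totalDeg β < totalDeg (β + Pi.single i 1) := by simp [totalDeg_add]
  refine ⟨w, hw, ?_⟩
  have key : E.x i * f - E.ι (E.σ i b * w) * monom E.x (β + Pi.single i 1) =
      E.x i * (f - E.ι b * monom E.x β) +
      (E.ι (E.σ i b) * (E.x i * monom E.x β - E.ι w * monom E.x (β + Pi.single i 1)) +
      E.ι (E.δ i b) * monom E.x β) := by
    simp only [mul_sub, x_mul_ι_mul, map_mul, mul_assoc]
    abel
  rw [key]
  exact add_mem (x_mul_mem_below hd i hf) (monomSpan_totalDeg_le_below hβ
    (add_mem (ι_mul_mem_monomSpan _ hw') (term_mem_monomSpan _ (le_refl (totalDeg β)))))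

lemma eq_zero_of_mul_σ (hrig : E.SigmaRigid) (i : Fin n) {a : R} (h : a * E.σ i a = 0) :
    a = 0 :=
  hrig a (Pi.single i 1) (by simpa [sigmaPow_single] using h)

lemma σ_idempotent (hrig : E.SigmaRigid) (hAb : IsAbelianRing R) (i : Fin n) {e : R}
    (he : e * e = e) : E.σ i e = e := by
  have hσ : E.σ i e * E.σ i e = E.σ i e := by rw [← map_mul, he]
  have hσσ : E.σ i (E.σ i e) * E.σ i (E.σ i e) = E.σ i (E.σ i e) := by rw [← map_mul, hσ]
  have h1 : e - e * E.σ i e = 0 := by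
    apply eq_zero_of_mul_σ hrig i
    have : E.σ i e * (E.σ i e - E.σ i e * E.σ i (E.σ i e)) =
      E.σ i e - E.σ i e * E.σ i (E.σ i e) := by rw [mul_sub, ← mul_assoc, hσ]
    rw [map_sub, map_mul, ← this, ← mul_assoc, sub_mul, mul_assoc, hσ, sub_self, zero_mul]
  have h2 : E.σ i e - E.σ i e * e = 0 := by
    apply eq_zero_of_mul_σ hrig i
    have : E.σ i (E.σ i e) - E.σ i (E.σ i e) * E.σ i e =
        (1 - E.σ i e) * E.σ i (E.σ i e) := by
      rw [hAb _ hσσ, sub_mul, one_mul]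
    have h : (E.σ i e - E.σ i e * e) * (1 - E.σ i e) = 0 := by
      rw [mul_sub, mul_one, sub_mul, hσ, mul_assoc, hAb e he, ← mul_assoc, hσ, sub_self]
    rw [map_sub, map_mul, this, ← mul_assoc, h, zero_mul]
  rw [sub_eq_zero] at h1 h2
  rw [h2, hAb _ hσ, ← h1]

lemma δ_idempotent (hrig : E.SigmaRigid) (hAb : IsAbelianRing R) (i : Fin n) {e : R}
    (he : e * e = e) : E.δ i e = 0 := by
  have h := E.δ_leibniz i e e
  rw [he, σ_idempotent hrig hAb i he, ← hAb e he] at h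
  have h' : e * E.δ i e = e * E.δ i e + e * E.δ i e := by
    conv_lhs => rw [h]
    rw [mul_add, ← mul_assoc, he]
  rw [left_eq_add] at h'
  rw [h, h', add_zero]

lemma ι_idempotent_central (hrig : E.SigmaRigid) (hAb : IsAbelianRing R) {e : R}
    (he : e * e = e) (f : A) : Commute (E.ι e) f := by
  have hx : ∀ i, Commute (E.ι e) (E.x i) := fun i => by
    rw [commute_iff_eq, E.comm_rel, σ_idempotent hrig hAb i he, δ_idempotent hrig hAb i he,
      map_zero, add_zero]
  have hm : ∀ α, Commute (E.ι e) (monom E.x α) := fun α => by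
    refine Commute.list_prod_right _ _ fun y hy => ?_
    obtain ⟨i, rfl⟩ := List.mem_ofFn.mp hy
    exact (hx i).pow_right _
  rw [← E.sum_coeff f]
  refine Commute.sum_right _ _ _ fun α _ => Commute.mul_right ?_ (hm α)
  rw [commute_iff_eq, ← map_mul, ← map_mul, hAb e he]

lemma monom_mul_lead (hbij : E.Bijective) (hrig : E.SigmaRigid) (hAb : IsAbelianRing R)
    (α : Fin n → ℕ) {β : Fin n → ℕ} {b : R} {g : A}
    (hg : g - E.ι b * monom E.x β ∈ E.below β) :
    ∃ c : R, (∀ u : R, u * u = u → u * c = 0 → u * b = 0) ∧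
      monom E.x α * g - E.ι c * monom E.x (α + β) ∈ E.below (α + β) := by
  induction hk : totalDeg α generalizing α with
  | zero =>
    obtain rfl : α = 0 := by
      ext i
      simpa using Finset.sum_eq_zero_iff.mp hk i (Finset.mem_univ i)
    exact ⟨b, fun _ _ h => h, by simpa using hg⟩
  | succ k ih =>
    obtain ⟨j, α', rfl, hlt, -⟩ := exists_eq_add_single (α := α) (by
      rintro rfl
      simp [totalDeg] at hk)
    obtain ⟨c, hc, hc'⟩ := ih α' (by simpa [totalDeg_add] using hk)
    obtain ⟨w, hw, hw'⟩ := x_mul_lead hbij.2 j hc'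
    refine ⟨E.σ j c * w, fun u hu huc => hc u hu ?_, ?_⟩
    · rw [← mul_assoc, hw.mul_left_eq_zero] at huc
      apply E.σ_inj j
      rw [map_mul, σ_idempotent hrig hAb j hu, huc, map_zero]
    · rwa [← mul_monom_of_forall_lt E.x j α' hlt, mul_assoc, add_right_comm]

lemma exists_lead {f : A} (hf : f ≠ 0) :
    ∃ α, E.coeff f α ≠ 0 ∧ ∀ β, E.coeff f β ≠ 0 → β ≠ α → degLexKey β < degLexKey α := by
  have hne : (E.coeff f).support.Nonempty :=
    Finsupp.support_nonempty_iff.mpr (mt E.coeff_eq_zero_iff.mp hf)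
  obtain ⟨α, hα, hmax⟩ := Finset.exists_max_image _ degLexKey hne
  exact ⟨α, Finsupp.mem_support_iff.mp hα, fun β hβ hne =>
    lt_of_le_of_ne (hmax β (Finsupp.mem_support_iff.mpr hβ)) (degLexKey_injective.ne hne)⟩

lemma eq_term_add_sum {f : A} (α : Fin n → ℕ) :
    f = E.ι (E.coeff f α) * monom E.x α +
      ∑ β ∈ (E.coeff f).support.erase α, E.ι (E.coeff f β) * monom E.x β := by
  classical
  by_cases h : α ∈ (E.coeff f).support
  · rw [Finset.add_sum_erase _ (fun β => E.ι (E.coeff f β) * monom E.x β) h]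
    exact (E.sum_coeff f).symm
  · rw [Finset.erase_eq_of_notMem h, Finsupp.notMem_support_iff.mp h, map_zero, zero_mul,
      zero_add]
    exact (E.sum_coeff f).symm

lemma sub_lead_mem_below {f : A} {α : Fin n → ℕ}
    (h : ∀ β, E.coeff f β ≠ 0 → β ≠ α → degLexKey β < degLexKey α) :
    f - E.ι (E.coeff f α) * monom E.x α ∈ E.below α := by
  nth_rw 1 [eq_term_add_sum (E := E) (f := f) α]
  rw [add_sub_cancel_left]
  refine sum_mem fun β hβ => term_mem_monomSpan _ ?_
  rw [Finset.mem_erase, Finsupp.mem_support_iff] at hβ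
  exact h β hβ.2 hβ.1

lemma mul_lead (hbij : E.Bijective) (hrig : E.SigmaRigid) (hAb : IsAbelianRing R)
    {f g : A} {α β : Fin n → ℕ} {b : R}
    (hf : ∀ γ, E.coeff f γ ≠ 0 → γ ≠ α → degLexKey γ < degLexKey α)
    (hg : g - E.ι b * monom E.x β ∈ E.below β) :
    ∃ c : R, (∀ u : R, u * u = u → u * c = 0 → u * b = 0) ∧
      f * g - E.ι (E.coeff f α * c) * monom E.x (α + β) ∈ E.below (α + β) := by
  obtain ⟨c, hc, hc'⟩ := monom_mul_lead hbij hrig hAb α hg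
  refine ⟨c, hc, ?_⟩
  have key : f * g - E.ι (E.coeff f α * c) * monom E.x (α + β) =
      E.ι (E.coeff f α) * (monom E.x α * g - E.ι c * monom E.x (α + β)) +
      ∑ γ ∈ (E.coeff f).support.erase α, E.ι (E.coeff f γ) * (monom E.x γ * g) := by
    nth_rw 1 [eq_term_add_sum (E := E) (f := f) α]
    simp only [add_mul, Finset.sum_mul, mul_sub, map_mul, mul_assoc]
    abel
  rw [key]
  refine add_mem (ι_mul_mem_monomSpan _ hc') (sum_mem fun γ hγ => ι_mul_mem_monomSpan _ ?_)
  rw [Finset.mem_erase, Finsupp.mem_support_iff] at hγ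
  have hlt := degLexKey_add_lt_add_right (hf γ hγ.2 hγ.1) β
  obtain ⟨c', -, hc'⟩ := monom_mul_lead hbij hrig hAb γ hg
  rw [← sub_add_cancel (monom E.x γ * g) (E.ι c' * monom E.x (γ + β))]
  exact add_mem (monomSpan_mono (fun μ hμ => lt_trans hμ hlt) hc') (term_mem_monomSpan _ hlt)

lemma ι_mul_eq_zero_of_mul_eq_zero (hbij : E.Bijective) (hrig : E.SigmaRigid)
    (hAb : IsAbelianRing R) {f g : A} {α : Fin n → ℕ}
    (hf : ∀ γ, E.coeff f γ ≠ 0 → γ ≠ α → degLexKey γ < degLexKey α) {u : R} (hu : u * u = u)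
    (hann : ∀ r, E.coeff f α * r = 0 → u * r = 0) (hfg : f * g = 0) : E.ι u * g = 0 := by
  by_contra hne
  obtain ⟨β, hβ, hmax⟩ := exists_lead (E := E) hne
  obtain ⟨c, hc, hc'⟩ := mul_lead hbij hrig hAb hf (sub_lead_mem_below hmax)
  have hzero : f * (E.ι u * g) = 0 := by
    rw [← mul_assoc, ← (ι_idempotent_central hrig hAb hu f).eq, mul_assoc, hfg, mul_zero]
  have hac : E.coeff f α * c = 0 := by
    have := coeff_eq_zero_of_mem_monomSpan hc' (lt_irrefl (degLexKey (α + β)))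
    rwa [hzero, zero_sub, coeff_neg, coeff_term, Finsupp.neg_apply, Finsupp.single_eq_same,
      neg_eq_zero] at this
  apply hβ
  have := hc u hu (hann c hac)
  rwa [coeff_ι_mul, ← mul_assoc, hu, ← coeff_ι_mul] at this

lemma exists_idempotent_and_iff (hAb : IsAbelianRing R) {e e' : R} (he : e * e = e)
    (he' : e' * e' = e') : ∃ v : R, v * v = v ∧
      ∀ g : A, (E.ι e * g = 0 ∧ E.ι e' * g = 0) ↔ E.ι v * g = 0 := by
  have h1 : e * (e + e' - e' * e) = e := by
    rw [mul_sub, mul_add, he, ← mul_assoc, hAb e he e', mul_assoc, he, add_sub_cancel_right]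
  have h2 : e' * (e + e' - e' * e) = e' := by
    rw [mul_sub, mul_add, he', ← mul_assoc, he', add_sub_cancel_left]
  refine ⟨e + e' - e' * e, ?_, fun g => ⟨fun ⟨h, h'⟩ => ?_, fun h => ⟨?_, ?_⟩⟩⟩
  · rw [sub_mul, add_mul, mul_assoc e' e, h1, h2]
  · rw [map_sub, map_add, map_mul, sub_mul, add_mul, mul_assoc, h, h']
    simp
  · rw [← h1, map_mul, mul_assoc, h, mul_zero]
  · rw [← h2, map_mul, mul_assoc, h, mul_zero]

/-- The right annihilator of an element of `A` is the right annihilator of an idempotent of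
`R`. -/
lemma exists_idempotent_mul_eq_zero_iff (hbij : E.Bijective) (hrig : E.SigmaRigid)
    (hAb : IsAbelianRing R) (hpp : IsRightPP R) (f : A) :
    ∃ e : R, e * e = e ∧ ∀ g, f * g = 0 ↔ E.ι e * g = 0 := by
  induction hk : (E.coeff f).support.card using Nat.strong_induction_on generalizing f with
  | _ k ih =>
  by_cases hf0 : f = 0
  · exact ⟨0, by simp, by simp [hf0]⟩
  obtain ⟨α, hα, hf⟩ := exists_lead (E := E) hf0
  obtain ⟨p, hp, hann⟩ := hpp (E.coeff f α)
  have hap : E.coeff f α * p = 0 := by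
    have : p ∈ rAnn {E.coeff f α} := by
      rw [hann]
      exact ⟨p, hp⟩
    exact this _ rfl
  have hu : (1 - p) * (1 - p) = 1 - p := by
    rw [mul_sub, sub_mul, sub_mul, hp]
    simp
  have hlt : (E.coeff (E.ι p * f)).support.card < k := by
    rw [← hk]
    refine Finset.card_lt_card (Finset.ssubset_iff_of_subset (fun β hβ => ?_) |>.mpr
      ⟨α, Finsupp.mem_support_iff.mpr hα, ?_⟩)
    · rw [Finsupp.mem_support_iff, coeff_ι_mul] at hβ
      exact Finsupp.mem_support_iff.mpr (right_ne_zero_of_mul hβ)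
    · rw [Finsupp.notMem_support_iff, coeff_ι_mul, hAb p hp, hap]
  obtain ⟨e, he, he'⟩ := ih _ hlt (E.ι p * f) rfl
  obtain ⟨v, hv, hv'⟩ := exists_idempotent_and_iff (E := E) hAb hu he
  refine ⟨v, hv, fun g => ?_⟩
  rw [← hv' g, ← he']
  refine ⟨fun h => ⟨ι_mul_eq_zero_of_mul_eq_zero hbij hrig hAb hf hu (fun r hr => ?_) h, ?_⟩,
    fun ⟨h, h'⟩ => ?_⟩
  · have : r ∈ rIdeal p := by
      rw [← hann]
      rintro _ rfl
      exact hr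
    obtain ⟨s, rfl⟩ := this
    simp only [← mul_assoc, sub_mul, one_mul, hp, sub_self, zero_mul]
  · rw [mul_assoc, h, mul_zero]
  · rw [map_sub, map_one, sub_mul, one_mul, sub_eq_zero] at h
    rw [h, ← mul_assoc, ← (ι_idempotent_central hrig hAb hp f).eq, h']

lemma exists_idempotent_forall_mul_eq_zero_iff (hbij : E.Bijective) (hrig : E.SigmaRigid)
    (hAb : IsAbelianRing R) (hpp : IsRightPP R) {m : ℕ} (a : Fin m → A) :
    ∃ e : R, e * e = e ∧ ∀ g, (∀ i, a i * g = 0) ↔ E.ι e * g = 0 := by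
  induction m with
  | zero => exact ⟨0, by simp, by simp⟩
  | succ m ih =>
    obtain ⟨e, he, hea⟩ := exists_idempotent_mul_eq_zero_iff hbij hrig hAb hpp (a 0)
    obtain ⟨e', he', hea'⟩ := ih fun i => a i.succ
    obtain ⟨v, hv, hv'⟩ := exists_idempotent_and_iff (E := E) hAb he he'
    exact ⟨v, hv, fun g => by rw [Fin.forall_fin_succ, hea, hea', hv']⟩

end SkewPBWExt

/-- If the extension is bijective and `R` is `Σ`-rigid, Abelian, NI and a right
p.p.-ring, then the skew PBW extension `A` has Property (a.c.) on the right. -/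
theorem bijective_rigid_rightPP_hasRightAC {R A : Type*} [Ring R] [Ring A] {n : ℕ} (E : SkewPBWExt R A n)
    (hbij : E.Bijective) (hrig : E.SigmaRigid) (hAb : IsAbelianRing R)
    (hNI : IsNIRing R) (hpp : IsRightPP R) :
    HasRightAC A := by
  intro m a
  obtain ⟨e, -, he⟩ := SkewPBWExt.exists_idempotent_forall_mul_eq_zero_iff hbij hrig hAb hpp a
  refine ⟨E.ι e, Set.ext fun g => ⟨?_, ?_⟩⟩
  · rintro h _ ⟨s, rfl⟩
    simp only [mul_assoc]
    refine (he _).mp fun i => ?_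
    rw [← mul_assoc]
    refine h _ ⟨Pi.single i s, ?_⟩
    rw [Finset.sum_eq_single i (fun j _ hj => by simp [hj]) (by simp), Pi.single_eq_same]
  · rintro h _ ⟨s, rfl⟩
    rw [Finset.sum_mul]
    refine Finset.sum_eq_zero fun i _ => ?_
    rw [mul_assoc]
    refine (he _).mpr ?_ i
    rw [← mul_assoc]
    exact h _ ⟨s i, rfl⟩
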